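/- Let p₁, …, pₙ ∈ ℝ³ be pairwise distinct sites with associated nonzero vectors v₁, …, vₙ, and let F be the projection distance field. If x ∈ ℝ³ has a unique nearest site p_i and satisfies (x − p_i)·v_i ≠ 0, then F is differentiable at x with gradient ∇F(x) = sign((x − p_i)·v_i) · v_i / ‖v_i‖; in particular ‖∇F(x)‖ = 1, so the projection distance field has unit gradient magnitude at all such points. -/

import Mathlib

open RealInnerProductSpace

/-- If `x` has the unique nearest site `p i`, then every nearest-site selection is constantly `i`
near `x`. -/
theorem eventually_nearest_eq {E ι : Type*} [SeminormedAddCommGroup E] [Finite ι]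
    {p : ι → E} {nearest : E → ι} (hnear : ∀ x j, ‖x - p (nearest x)‖ ≤ ‖x - p j‖)
    {x : E} {i : ι} (hxi : ∀ j, j ≠ i → ‖x - p i‖ < ‖x - p j‖) :
    ∀ᶠ y in nhds x, nearest y = i := by
  have h : ∀ᶠ y in nhds x, ∀ j, j ≠ i → ‖y - p i‖ < ‖y - p j‖ := by
    refine Filter.eventually_all.2 fun j => ?_
    by_cases hj : j = i
    · simp [hj]
    · have hlt : ∀ᶠ y in nhds x, ‖y - p i‖ < ‖y - p j‖ :=
        ContinuousAt.eventually_lt (by fun_prop) (by fun_prop) (hxi j hj)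
      exact hlt.mono fun y hy _ => hy
  filter_upwards [h] with y hy
  by_contra hne
  exact absurd (hnear y i) (not_le.2 (hy _ hne))

/-- The affine function `y ↦ ⟪w, y - q⟫` has gradient `w`. -/
theorem hasGradientAt_inner_sub {E : Type*} [NormedAddCommGroup E] [InnerProductSpace ℝ E]
    [CompleteSpace E] (w q x : E) : HasGradientAt (fun y => ⟪w, y - q⟫) w x := by
  rw [hasGradientAt_iff_hasFDerivAt]
  simpa [inner_sub_right] using
    ((InnerProductSpace.toDual ℝ E w).hasFDerivAt (x := x)).sub_const ⟪w, q⟫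

/-- The projection distance to a site has gradient `± v / ‖v‖` wherever it does not vanish. -/
theorem hasGradientAt_abs_inner_div_norm {E : Type*} [NormedAddCommGroup E]
    [InnerProductSpace ℝ E] [CompleteSpace E] {q v x : E} (hne : ⟪x - q, v⟫ ≠ 0) :
    HasGradientAt (fun y => |⟪y - q, v⟫| / ‖v‖)
      (Real.sign ⟪x - q, v⟫ • (‖v‖⁻¹ • v)) x := by
  refine (hasGradientAt_inner_sub _ q x).congr_of_eventuallyEq ?_
  have hcont : ContinuousAt (fun y => ⟪y - q, v⟫) x := by fun_prop
  rcases lt_or_gt_of_ne hne with h | h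
  · filter_upwards [hcont.eventually_lt continuousAt_const h] with y hy
    rw [Real.sign_of_neg h, abs_of_neg hy, inner_smul_left, inner_smul_left, real_inner_comm]
    simp [div_eq_inv_mul]
  · filter_upwards [continuousAt_const.eventually_lt hcont h] with y hy
    rw [Real.sign_of_pos h, abs_of_pos hy, inner_smul_left, inner_smul_left, real_inner_comm]
    simp [div_eq_inv_mul]

/-- At a point with a unique nearest site `pᵢ` where `(x − pᵢ)·vᵢ ≠ 0`, the
projection distance field is differentiable with gradient
`sign((x − pᵢ)·vᵢ) · vᵢ / ‖vᵢ‖`, which has unit norm. -/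
theorem projField_unit_gradient
    (n : ℕ) (p v : Fin n → EuclideanSpace ℝ (Fin 3))
    (hp : Function.Injective p)
    (hv : ∀ i, v i ≠ 0)
    (nearest : EuclideanSpace ℝ (Fin 3) → Fin n)
    (hnear : ∀ x j, ‖x - p (nearest x)‖ ≤ ‖x - p j‖)
    (F : EuclideanSpace ℝ (Fin 3) → ℝ)
    (hF : ∀ x, F x = |⟪x - p (nearest x), v (nearest x)⟫| / ‖v (nearest x)‖)
    (x : EuclideanSpace ℝ (Fin 3)) (i : Fin n)
    (hxi : ∀ j, j ≠ i → ‖x - p i‖ < ‖x - p j‖)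
    (hne : ⟪x - p i, v i⟫ ≠ 0) :
    HasGradientAt F (Real.sign ⟪x - p i, v i⟫ • (‖v i‖⁻¹ • v i)) x ∧
    ‖Real.sign ⟪x - p i, v i⟫ • (‖v i‖⁻¹ • v i)‖ = 1 := by
  constructor
  · refine (hasGradientAt_abs_inner_div_norm hne).congr_of_eventuallyEq ?_
    filter_upwards [eventually_nearest_eq hnear hxi] with y hy
    rw [hF y, hy]
  · have hsign : ‖Real.sign ⟪x - p i, v i⟫‖ = 1 := by
      rcases Real.sign_apply_eq_of_ne_zero _ hne with h | h <;> simp [h]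
    rw [norm_smul, hsign, one_mul, norm_smul, norm_inv, norm_norm,
      inv_mul_cancel₀ (norm_ne_zero_iff.2 (hv i))]
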